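/- arXiv:math/0207105 — 3 statements merged into one kernel-verified Lean document; each statement's English description precedes it below -/
import Mathlib

section
/- For every r ≥ 0 and every v ∈ O_m, one has 2^{m−1}·#{S ⊆ O_m : |S| = 2r + 1, ∑S = v} = (2^{m−1} − 2r)·a_{2r}(O_m) + (2r + 2)·a_{2r+2}(O_m). -/
open Finset Polynomial

/-- The ambient 𝔽₂-vector space `V = (ZMod 2)^m`. -/
abbrev V (m : ℕ) := Fin m → ZMod 2

/-- `Hm m` is the set of the `2^m - 1` nonzero vectors of `V m`. -/
def Hm (m : ℕ) : Finset (V m) := Finset.univ.filter (fun v => v ≠ 0)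

/-- `Om m` is the set of odd-weight vectors of `V m`. -/
def Om (m : ℕ) : Finset (V m) := Finset.univ.filter (fun v => (∑ i, v i) = 1)

/-- `Em m` is the set of nonzero even-weight vectors of `V m`. -/
def Em (m : ℕ) : Finset (V m) := Finset.univ.filter (fun v => v ≠ 0 ∧ (∑ i, v i) = 0)

/-- The number of `i`-element subsets of `d` whose elements sum to `ψ`. -/
def sumCount (m : ℕ) (d : Finset (V m)) (i : ℕ) (ψ : V m) : ℕ :=
  ((d.powersetCard i).filter (fun S => S.sum id = ψ)).card

/-- `wordCount m d i = a_i(d)`, the number of `i`-element subsets of `d` summing to `0`. -/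
def wordCount (m : ℕ) (d : Finset (V m)) (i : ℕ) : ℕ := sumCount m d i 0

/-- The rank of a finite set of vectors: the dimension of its span over `𝔽₂`. -/
noncomputable def rankOf (m : ℕ) (f : Finset (V m)) : ℕ :=
  Module.finrank (ZMod 2) (Submodule.span (ZMod 2) (f : Set (V m)))

/-- `d₁` has smaller aberration than `d₂`. -/
def SmallerAberration (m : ℕ) (d₁ d₂ : Finset (V m)) : Prop :=
  ∃ s, 1 ≤ s ∧ wordCount m d₁ s < wordCount m d₂ s ∧
    ∀ t < s, wordCount m d₁ t = wordCount m d₂ t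

/-- `d` is a minimum aberration design. -/
def IsMA (m : ℕ) (d : Finset (V m)) : Prop :=
  d ⊆ Hm m ∧ ∀ d' ⊆ Hm m, d'.card = d.card → ¬ SmallerAberration m d' d

/-- The word-length pattern polynomial `P_f(X) = ∑ a_i(f) X^i` of a design `f`. -/
noncomputable def WLPP (m : ℕ) (f : Finset (V m)) : Polynomial ℤ :=
  ∑ i ∈ Finset.range (f.card + 1), (wordCount m f i : ℤ) • X ^ i

/-- `Q_ψ(X) = ∑ q_i(ψ) X^i`, where `q_i(ψ)` counts `i`-element subsets of `O_m` summing to `ψ`. -/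
noncomputable def Qpoly (m : ℕ) (ψ : V m) : Polynomial ℤ :=
  ∑ i ∈ Finset.range ((Om m).card + 1), (sumCount m (Om m) i ψ : ℤ) • X ^ i

theorem V_add_self {m : ℕ} (v : V m) : v + v = 0 :=
  funext fun i => CharTwo.add_self_eq_zero (v i)

theorem mem_Om {m : ℕ} {v : V m} : v ∈ Om m ↔ ∑ i, v i = 1 := by
  simp [Om]

/-- Translation by an odd vector exchanges `Om m` and its complement, so `Om m` is half of `V m`. -/
theorem card_Om {m : ℕ} (hm : 1 ≤ m) : (Om m).card = 2 ^ (m - 1) := by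
  have hcompl : (Om m).card = (Om m)ᶜ.card := by
    let t : V m := Pi.single ⟨0, hm⟩ 1
    have ht : ∑ i, t i = 1 := by simp [t]
    have htt : t + t = 0 := V_add_self t
    refine card_nbij' (· + t) (· + t) ?_ ?_ ?_ ?_
    · intro v hv
      have hv := mem_Om.mp hv
      simp only [coe_compl, Set.mem_compl_iff, mem_coe, mem_Om, Pi.add_apply, sum_add_distrib,
        hv, ht]
      decide
    · intro v hv
      simp only [coe_compl, Set.mem_compl_iff, mem_coe, mem_Om] at hv
      simp only [mem_coe, mem_Om, Pi.add_apply, sum_add_distrib, ht]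
      generalize (∑ i, v i) = x at hv
      revert hv
      revert x
      decide
    · intro v _
      simp [add_assoc, htt]
    · intro v _
      simp [add_assoc, htt]
  have hV : Fintype.card (V m) = 2 ^ m := by simp [ZMod.card]
  have htotal := card_add_card_compl (Om m)
  obtain ⟨k, rfl⟩ : ∃ k, m = k + 1 := ⟨m - 1, by omega⟩
  rw [hV, ← hcompl, pow_succ] at htotal
  simp only [Nat.add_sub_cancel]
  omega

/-- Odd-size subsets of `Om m` are equidistributed over the odd sums, by translation. -/
theorem sumCount_Om_le {m k : ℕ} (hk : Odd k) {v w : V m} (hv : v ∈ Om m) (hw : w ∈ Om m) :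
    sumCount m (Om m) k v ≤ sumCount m (Om m) k w := by
  rw [mem_Om] at hv hw
  refine card_le_card_of_injOn (fun S => S.map (addRightEmbedding (v + w))) ?_
    (fun S _ T _ h => map_injective _ h)
  intro S hS
  simp only [coe_filter, Set.mem_ofPred_eq, mem_powersetCard] at hS ⊢
  obtain ⟨⟨hsub, hcard⟩, hsum⟩ := hS
  refine ⟨⟨?_, by rw [card_map, hcard]⟩, ?_⟩
  · intro x hx
    obtain ⟨y, hy, rfl⟩ := mem_map.mp hx
    have hy := mem_Om.mp (hsub hy)
    simp only [addRightEmbedding_apply, mem_Om, Pi.add_apply, sum_add_distrib, hy, hv, hw]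
    decide
  · have hodd : k • (v + w) = v + w := by
      obtain ⟨j, rfl⟩ := hk
      rw [succ_nsmul, mul_comm, mul_nsmul, two_nsmul, V_add_self, zero_add]
    simp only [id] at hsum
    simp only [sum_map, addRightEmbedding_apply, id]
    rw [sum_add_distrib, sum_const, hcard, hsum, hodd, ← add_assoc, V_add_self,
      zero_add]

theorem sumCount_Om_eq {m k : ℕ} (hk : Odd k) {v w : V m} (hv : v ∈ Om m) (hw : w ∈ Om m) :
    sumCount m (Om m) k v = sumCount m (Om m) k w :=
  (sumCount_Om_le hk hv hw).antisymm (sumCount_Om_le hk hw hv)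

/-- The words of length `k` of `d`. -/
def wordsOf (m : ℕ) (d : Finset (V m)) (k : ℕ) : Finset (Finset (V m)) :=
  (d.powersetCard k).filter (fun S => S.sum id = 0)

theorem mem_wordsOf {m k : ℕ} {d S : Finset (V m)} :
    S ∈ wordsOf m d k ↔ (S ⊆ d ∧ S.card = k) ∧ S.sum id = 0 := by
  simp [wordsOf, mem_powersetCard]

/-- A `(k + 1)`-subset of `d` with sum `v` arises from a word of length `k` by adding `v`, or
from a word of length `k + 2` by deleting `v`. -/
theorem sumCount_succ {m k : ℕ} {d : Finset (V m)} {v : V m} (hv : v ∈ d) :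
    sumCount m d (k + 1) v =
      ((wordsOf m d k).filter (fun S => v ∉ S)).card +
        ((wordsOf m d (k + 2)).filter (fun S => v ∈ S)).card := by
  rw [sumCount, ← card_filter_add_card_filter_not (fun S => v ∈ S)]
  congr 1
  · refine card_nbij' (fun S => S.erase v) (fun S => insert v S) ?_ ?_ ?_ ?_
    · intro S hS
      simp only [coe_filter, mem_filter, Set.mem_ofPred_eq, mem_powersetCard, mem_wordsOf] at hS ⊢
      obtain ⟨⟨⟨hsub, hcard⟩, hsum⟩, hvS⟩ := hS
      refine ⟨⟨⟨(erase_subset _ _).trans hsub, by rw [card_erase_of_mem hvS, hcard]; rfl⟩, ?_⟩,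
        notMem_erase _ _⟩
      have h := add_sum_erase S id hvS
      rw [hsum] at h
      simpa using h
    · intro S hS
      simp only [coe_filter, mem_filter, Set.mem_ofPred_eq, mem_powersetCard, mem_wordsOf] at hS ⊢
      obtain ⟨⟨⟨hsub, hcard⟩, hsum⟩, hvS⟩ := hS
      exact ⟨⟨⟨insert_subset hv hsub, by rw [card_insert_of_notMem hvS, hcard]⟩,
        by rw [sum_insert hvS, hsum]; simp⟩, mem_insert_self _ _⟩
    · intro S hS
      exact insert_erase (mem_filter.mp hS).2
    · intro S hS
      exact erase_insert (mem_filter.mp hS).2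
  · refine card_nbij' (fun S => insert v S) (fun S => S.erase v) ?_ ?_ ?_ ?_
    · intro S hS
      simp only [coe_filter, mem_filter, Set.mem_ofPred_eq, mem_powersetCard, mem_wordsOf] at hS ⊢
      obtain ⟨⟨⟨hsub, hcard⟩, hsum⟩, hvS⟩ := hS
      exact ⟨⟨⟨insert_subset hv hsub, by rw [card_insert_of_notMem hvS, hcard]⟩,
        by rw [sum_insert hvS, hsum]; exact V_add_self v⟩, mem_insert_self _ _⟩
    · intro S hS
      simp only [coe_filter, mem_filter, Set.mem_ofPred_eq, mem_powersetCard, mem_wordsOf] at hS ⊢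
      obtain ⟨⟨⟨hsub, hcard⟩, hsum⟩, hvS⟩ := hS
      refine ⟨⟨⟨(erase_subset _ _).trans hsub, by rw [card_erase_of_mem hvS, hcard]; rfl⟩, ?_⟩,
        notMem_erase _ _⟩
      have h := add_sum_erase S id hvS
      rw [hsum, id, ← V_add_self v] at h
      exact add_left_cancel h
    · intro S hS
      exact erase_insert (mem_filter.mp hS).2
    · intro S hS
      exact insert_erase (mem_filter.mp hS).2

theorem sum_card_words_mem (m k : ℕ) (d : Finset (V m)) :
    ∑ w ∈ d, ((wordsOf m d k).filter (fun S => w ∈ S)).card = k * wordCount m d k := by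
  have h := sum_card_bipartiteAbove_eq_sum_card_bipartiteBelow (s := d) (t := wordsOf m d k)
    (fun w S => w ∈ S)
  simp only [bipartiteAbove, bipartiteBelow] at h
  rw [h, sum_const_nat (m := k), mul_comm]
  · rfl
  · intro S hS
    obtain ⟨⟨hsub, hcard⟩, -⟩ := mem_wordsOf.mp hS
    rw [filter_mem_eq_inter, inter_eq_right.mpr hsub, hcard]

theorem sum_card_words_notMem_add (m k : ℕ) (d : Finset (V m)) :
    ∑ w ∈ d, ((wordsOf m d k).filter (fun S => w ∉ S)).card + k * wordCount m d k =
      d.card * wordCount m d k := by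
  rw [← sum_card_words_mem, ← sum_add_distrib, sum_const_nat (m := wordCount m d k)]
  intro w _
  rw [add_comm, card_filter_add_card_filter_not]
  rfl

/-- For `r ≥ 0` and `v ∈ O_m`,
`2^{m-1} · #{S ⊆ O_m : |S| = 2r+1, ∑S = v} = (2^{m-1} - 2r)·a_{2r}(O_m) + (2r+2)·a_{2r+2}(O_m)`. -/
theorem odd_chain_count_formula (m : ℕ) (hm : 2 ≤ m)
    (r : ℕ) (v : V m) (hv : v ∈ Om m) :
    (2 ^ (m - 1) : ℤ) * sumCount m (Om m) (2 * r + 1) v =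
      ((2 ^ (m - 1) : ℤ) - 2 * r) * wordCount m (Om m) (2 * r) +
        (2 * (r : ℤ) + 2) * wordCount m (Om m) (2 * r + 2) := by
  have htotal : 2 ^ (m - 1) * sumCount m (Om m) (2 * r + 1) v =
      ∑ w ∈ Om m, ((wordsOf m (Om m) (2 * r)).filter (fun S => w ∉ S)).card +
        (2 * r + 2) * wordCount m (Om m) (2 * r + 2) := by
    rw [← sum_card_words_mem, ← sum_add_distrib, ← card_Om (by omega : 1 ≤ m)]
    refine (sum_const_nat fun w hw => ?_).symm
    rw [← sumCount_succ hw]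
    exact sumCount_Om_eq ⟨r, rfl⟩ hw hv
  have hnot := sum_card_words_notMem_add m (2 * r) (Om m)
  rw [card_Om (by omega : 1 ≤ m)] at hnot
  zify at htotal hnot
  linear_combination htotal + hnot
end

section
/- Let e ⊆ E_m with |e| = r and let ψ ∈ E_m. Then in ℤ[X]: P_{O_m ∪ e}(X) = (1 + X)^r · Q_ψ(X) + P_e(X) · (P_{O_m}(X) − Q_ψ(X)). -/
open Finset Polynomial

/-- The generating polynomial, by cardinality, of the subsets of `d` that sum to `φ`. -/
noncomputable def sumGen (m : ℕ) (d : Finset (V m)) (φ : V m) : Polynomial ℤ :=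
  ∑ S ∈ d.powerset, if S.sum id = φ then X ^ S.card else 0

lemma sumGen_eq_sum_sumCount (m : ℕ) (d : Finset (V m)) (φ : V m) :
    sumGen m d φ = ∑ i ∈ Finset.range (d.card + 1), (sumCount m d i φ : ℤ) • X ^ i := by
  rw [sumGen, Finset.sum_powerset]
  refine Finset.sum_congr rfl fun i _ => ?_
  rw [sumCount, ← Finset.sum_filter, Finset.sum_congr rfl (g := fun _ => X ^ i)]
  · simp
  · intro S hS
    rw [(Finset.mem_powersetCard.mp (Finset.mem_filter.mp hS).1).2]

lemma sumGen_empty (m : ℕ) (φ : V m) : sumGen m ∅ φ = if φ = 0 then 1 else 0 := by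
  simp [sumGen, eq_comm]

lemma sumGen_insert (m : ℕ) {d : Finset (V m)} {a : V m} (ha : a ∉ d) (φ : V m) :
    sumGen m (insert a d) φ = sumGen m d φ + X * sumGen m d (φ - a) := by
  rw [sumGen, Finset.sum_powerset_insert ha, sumGen, sumGen, Finset.mul_sum]
  congr 1
  refine Finset.sum_congr rfl fun S hS => ?_
  have haS : a ∉ S := fun h => ha (Finset.mem_powerset.mp hS h)
  rw [Finset.sum_insert haS, Finset.card_insert_of_notMem haS, id, mul_ite, mul_zero, pow_succ']
  simp only [eq_sub_iff_add_eq']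

lemma sumGen_map (m : ℕ) (d : Finset (V m)) (T : V m ≃+ V m) (φ : V m) :
    sumGen m (d.map T.toEquiv.toEmbedding) (T φ) = sumGen m d φ := by
  induction d using Finset.induction_on generalizing φ with
  | empty => simp [sumGen_empty]
  | insert a d ha ih =>
    rw [Finset.map_insert, sumGen_insert m (by simpa using ha), sumGen_insert m ha, ih]
    congr 2
    rw [← ih, map_sub]
    rfl

/-- Any two nonzero vectors over `𝔽₂` take the value one under a common linear functional. -/
lemma exists_functional_eq_one {m : ℕ} {φ ψ : V m} (hφ : φ ≠ 0) (hψ : ψ ≠ 0) :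
    ∃ f : V m →+ ZMod 2, f φ = 1 ∧ f ψ = 1 := by
  have eq_one : ∀ x : ZMod 2, x ≠ 0 → x = 1 := by decide
  obtain ⟨i, hi⟩ := Function.ne_iff.mp hφ
  obtain ⟨j, hj⟩ := Function.ne_iff.mp hψ
  by_cases hi' : ψ i = 0
  · by_cases hj' : φ j = 0
    · refine ⟨Pi.evalAddMonoidHom (fun _ => ZMod 2) i + 
        Pi.evalAddMonoidHom (fun _ => ZMod 2) j, ?_, ?_⟩
      · simpa [hj'] using eq_one _ hi
      · simpa [hi'] using eq_one _ hj
    · exact ⟨Pi.evalAddMonoidHom (fun _ => ZMod 2) j, eq_one _ hj', eq_one _ hj⟩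
  · exact ⟨Pi.evalAddMonoidHom (fun _ => ZMod 2) i, eq_one _ hi, eq_one _ hi'⟩

/-- A transvection carries any element of `Em m` to any other while preserving parity. -/
lemma exists_addEquiv_of_mem_Em {m : ℕ} {φ ψ : V m} (hφ : φ ∈ Em m) (hψ : ψ ∈ Em m) :
    ∃ T : V m ≃+ V m, T φ = ψ ∧ ∀ v, ∑ i, T v i = ∑ i, v i := by
  simp only [Em, Finset.mem_filter, Finset.mem_univ, true_and] at hφ hψ
  obtain ⟨f, hfφ, hfψ⟩ := exists_functional_eq_one hφ.1 hψ.1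
  have hinv : Function.Involutive fun v : V m => v + f v • (φ + ψ) := by
    intro v
    have hf : f (f v • (φ + ψ)) = 0 := by
      rw [ZMod.map_smul, map_add, hfφ, hfψ, CharTwo.add_self_eq_zero, smul_zero]
    simp only [map_add f v, hf, add_zero]
    ext i
    simp [add_assoc, CharTwo.add_self_eq_zero]
  refine ⟨{ hinv.toPerm with map_add' := fun v w => ?_ }, ?_, fun v => ?_⟩
  · change v + w + f (v + w) • (φ + ψ) = v + f v • (φ + ψ) + (w + f w • (φ + ψ))
    rw [map_add, add_smul]
    abel
  · change φ + f φ • (φ + ψ) = ψ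
    ext i
    simp [hfφ, ← add_assoc, CharTwo.add_self_eq_zero]
  · change ∑ i, (v i + f v * (φ i + ψ i)) = ∑ i, v i
    rw [Finset.sum_add_distrib, ← Finset.mul_sum, Finset.sum_add_distrib, hφ.2, hψ.2]
    simp

lemma sumGen_Om_eq_of_mem_Em {m : ℕ} {φ ψ : V m} (hφ : φ ∈ Em m) (hψ : ψ ∈ Em m) :
    sumGen m (Om m) φ = sumGen m (Om m) ψ := by
  obtain ⟨T, hT, hpar⟩ := exists_addEquiv_of_mem_Em hφ hψ
  have hmap : (Om m).map T.toEquiv.toEmbedding = Om m := by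
    refine Finset.eq_of_subset_of_card_le (fun v hv => ?_) (by rw [Finset.card_map])
    obtain ⟨w, hw, rfl⟩ := Finset.mem_map.mp hv
    simp only [Om, Finset.mem_filter, Finset.mem_univ, true_and] at hw ⊢
    exact (hpar w).trans hw
  rw [← sumGen_map m (Om m) T φ, hmap, hT]

lemma sumGen_Om_union {m : ℕ} {e : Finset (V m)} (he : e ⊆ Em m) {ψ : V m} (hψ : ψ ∈ Em m)
    {φ : V m} (hφ : ∑ i, φ i = 0) :
    sumGen m (Om m ∪ e) φ = (1 + X) ^ e.card * sumGen m (Om m) ψ +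
      sumGen m e φ * (sumGen m (Om m) 0 - sumGen m (Om m) ψ) := by
  induction e using Finset.induction_on generalizing φ with
  | empty =>
    rw [Finset.union_empty, sumGen_empty]
    split_ifs with h
    · simp [h]
    · simp [sumGen_Om_eq_of_mem_Em (by simp [Em, h, hφ] : φ ∈ Em m) hψ]
  | insert a e ha ih =>
    rw [Finset.insert_subset_iff] at he
    have haE : ∑ i, a i = 0 := by
      have := he.1
      simp only [Em, Finset.mem_filter] at this
      exact this.2.2
    have hau : a ∉ Om m ∪ e := by simp [Om, haE, ha]
    have hφa : ∑ i, (φ - a) i = 0 := by simp [Finset.sum_sub_distrib, hφ, haE]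
    rw [Finset.union_insert, sumGen_insert m hau, sumGen_insert m ha, ih he.2 hφ, ih he.2 hφa,
      Finset.card_insert_of_notMem ha]
    ring

/-- For `e ⊆ E_m` with `|e| = r` and any `ψ ∈ E_m`, in `ℤ[X]`:
`P_{O_m ∪ e}(X) = (1+X)^r · Q_ψ(X) + P_e(X) · (P_{O_m}(X) - Q_ψ(X))`. -/
theorem WLPP_union_formula (m : ℕ) (hm : 2 ≤ m)
    (e : Finset (V m)) (he : e ⊆ Em m) (r : ℕ) (hr : e.card = r)
    (ψ : V m) (hψ : ψ ∈ Em m) :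
    WLPP m (Om m ∪ e) =
      (1 + Polynomial.X) ^ r * Qpoly m ψ + WLPP m e * (WLPP m (Om m) - Qpoly m ψ) := by
  subst hr
  simp only [WLPP, Qpoly, wordCount, ← sumGen_eq_sum_sumCount]
  exact sumGen_Om_union he hψ (by simp)
end

section
/- Let e₁, e₂ ⊆ E_m with |e₁| = |e₂|, and let ψ ∈ E_m. Then in ℤ[X]: P_{O_m ∪ e₁}(X) − P_{O_m ∪ e₂}(X) = (P_{e₁}(X) − P_{e₂}(X)) · (P_{O_m}(X) − Q_ψ(X)). -/
open Finset Polynomial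

/-- The generating polynomial, by cardinality, of the subsets of `d` that sum to `φ`. -/
noncomputable def subsetSumPoly (m : ℕ) (d : Finset (V m)) (φ : V m) : Polynomial ℤ :=
  ∑ S ∈ d.powerset, if S.sum id = φ then X ^ S.card else 0

theorem sum_sumCount_smul_eq_subsetSumPoly (m : ℕ) (d : Finset (V m)) (φ : V m) :
    ∑ i ∈ Finset.range (d.card + 1), (sumCount m d i φ : ℤ) • (X : Polynomial ℤ) ^ i =
      subsetSumPoly m d φ := by
  rw [subsetSumPoly, Finset.sum_powerset]
  refine Finset.sum_congr rfl fun i _ => ?_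
  rw [← Finset.sum_filter, sumCount, Finset.sum_congr rfl (g := fun _ => (X : Polynomial ℤ) ^ i),
    Finset.sum_const]
  · simp
  · intro S hS
    rw [(Finset.mem_powersetCard.1 (Finset.mem_filter.1 hS).1).2]

theorem subsetSumPoly_union (m : ℕ) {d e : Finset (V m)} (h : Disjoint d e) :
    subsetSumPoly m (d ∪ e) 0 =
      ∑ T ∈ e.powerset, X ^ T.card * subsetSumPoly m d (T.sum id) := by
  simp only [subsetSumPoly, Finset.mul_sum]
  rw [← Finset.sum_product']
  symm
  refine Finset.sum_nbij' (fun p => p.2 ∪ p.1) (fun S => (S ∩ e, S ∩ d)) ?_ ?_ ?_ ?_ ?_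
  · rintro ⟨T, U⟩ hp
    simp only [Finset.mem_product, Finset.mem_powerset] at hp ⊢
    exact Finset.union_subset_union hp.2 hp.1
  · intro S _
    simp [Finset.inter_subset_right]
  · rintro ⟨T, U⟩ hp
    simp only [Finset.mem_product, Finset.mem_powerset] at hp
    have h₁ : U ∩ e = ∅ := Finset.disjoint_iff_inter_eq_empty.1 (h.mono_left hp.2)
    have h₂ : T ∩ d = ∅ := Finset.disjoint_iff_inter_eq_empty.1 (h.symm.mono_left hp.1)
    simp [Finset.union_inter_distrib_right, h₁, h₂, Finset.inter_eq_left.2 hp.1,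
      Finset.inter_eq_left.2 hp.2]
  · intro S hS
    rw [← Finset.inter_union_distrib_left]
    exact Finset.inter_eq_left.2 (Finset.mem_powerset.1 hS)
  · rintro ⟨T, U⟩ hp
    simp only [Finset.mem_product, Finset.mem_powerset] at hp
    have hd : Disjoint U T := h.mono hp.2 hp.1
    have hiff : U.sum id = T.sum id ↔ U.sum id + T.sum id = 0 := by
      rw [← ZModModule.sub_eq_add, sub_eq_zero]
    rw [Finset.sum_union hd, Finset.card_union_of_disjoint hd, mul_ite, mul_zero, ← pow_add,
      add_comm T.card]
    simp only [hiff]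

theorem exists_linearMap_eq_one_eq_one (m : ℕ) {φ ψ : V m} (hφ : φ ≠ 0) (hψ : ψ ≠ 0) :
    ∃ f : V m →ₗ[ZMod 2] ZMod 2, f φ = 1 ∧ f ψ = 1 := by
  have hz : ∀ a : ZMod 2, a ≠ 0 → a = 1 := by decide
  obtain ⟨i, hi⟩ := Function.ne_iff.1 hφ
  obtain ⟨j, hj⟩ := Function.ne_iff.1 hψ
  by_cases hi' : ψ i = 0
  · by_cases hj' : φ j = 0
    · refine ⟨(LinearMap.proj i : V m →ₗ[ZMod 2] ZMod 2) + LinearMap.proj j, ?_, ?_⟩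
      · change φ i + φ j = 1
        rw [hj', add_zero, hz _ hi]
      · change ψ i + ψ j = 1
        rw [hi', zero_add, hz _ hj]
    · exact ⟨LinearMap.proj j, hz _ hj', hz _ hj⟩
  · exact ⟨LinearMap.proj i, hz _ hi, hz _ hi'⟩

theorem subsetSumPoly_Om_eq (m : ℕ) {φ ψ : V m} (hφ : φ ∈ Em m) (hψ : ψ ∈ Em m) :
    subsetSumPoly m (Om m) φ = subsetSumPoly m (Om m) ψ := by
  simp only [Em, Finset.mem_filter, Finset.mem_univ, true_and] at hφ hψ
  obtain ⟨f, hfφ, hfψ⟩ := exists_linearMap_eq_one_eq_one m hφ.1 hψ.1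
  let g : V m →ₗ[ZMod 2] V m := LinearMap.id + f.smulRight (φ + ψ)
  have hg : ∀ v, g v = v + f v • (φ + ψ) := fun v => rfl
  have hinv : Function.Involutive g := by
    intro v
    have hw : f (φ + ψ) = 0 := by rw [map_add, hfφ, hfψ]; decide
    rw [hg (g v), hg v, map_add, map_smul, hw, smul_zero, add_zero, add_assoc,
      ZModModule.add_self, add_zero]
  have hgφ : g φ = ψ := by
    rw [hg, hfφ, one_smul, ← add_assoc, ZModModule.add_self, zero_add]
  have hgO : ∀ v ∈ Om m, g v ∈ Om m := by
    intro v hv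
    simp only [Om, Finset.mem_filter, Finset.mem_univ, true_and] at hv ⊢
    simp [hg, Finset.sum_add_distrib, ← Finset.mul_sum, hv, hφ.2, hψ.2]
  have hmem : ∀ S ∈ (Om m).powerset, S.image g ∈ (Om m).powerset := by
    intro S hS
    rw [Finset.mem_powerset] at hS ⊢
    exact Finset.image_subset_iff.2 fun v hv => hgO v (hS hv)
  have himage : ∀ S : Finset (V m), (S.image g).image g = S := fun S => by
    rw [Finset.image_image, hinv.comp_self, Finset.image_id]
  refine Finset.sum_nbij' (fun S => S.image g) (fun S => S.image g) hmem hmem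
    (fun S _ => himage S) (fun S _ => himage S) fun S _ => ?_
  have hsum : (S.image g).sum id = g (S.sum id) := by
    rw [Finset.sum_image hinv.injective.injOn, map_sum]; rfl
  simp only [hsum, ← hgφ, hinv.injective.eq_iff, Finset.card_image_of_injective _ hinv.injective]

theorem subsetSumPoly_Om_union (m : ℕ) {e : Finset (V m)} (he : e ⊆ Em m) {ψ : V m}
    (hψ : ψ ∈ Em m) :
    subsetSumPoly m (Om m ∪ e) 0 =
      subsetSumPoly m e 0 * (subsetSumPoly m (Om m) 0 - subsetSumPoly m (Om m) ψ) +
        (X + 1) ^ e.card * subsetSumPoly m (Om m) ψ := by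
  have hdisj : Disjoint (Om m) e := by
    refine Finset.disjoint_left.2 fun v hv hve => ?_
    have h₁ := (Finset.mem_filter.1 hv).2
    rw [(Finset.mem_filter.1 (he hve)).2.2] at h₁
    exact zero_ne_one h₁
  rw [subsetSumPoly_union m hdisj, ← Finset.sum_pow_mul_eq_add_pow, subsetSumPoly.eq_1 m e,
    Finset.sum_mul, Finset.sum_mul, ← Finset.sum_add_distrib]
  refine Finset.sum_congr rfl fun T hT => ?_
  rw [one_pow, mul_one]
  split_ifs with h
  · rw [h]; ring
  · have hT' : T.sum id ∈ Em m := by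
      refine Finset.mem_filter.2 ⟨Finset.mem_univ _, h, ?_⟩
      simp only [Finset.sum_apply, id]
      rw [Finset.sum_comm]
      exact Finset.sum_eq_zero fun v hv =>
        (Finset.mem_filter.1 (he (Finset.mem_powerset.1 hT hv))).2.2
    rw [subsetSumPoly_Om_eq m hT' hψ]; ring

/-- For `e₁, e₂ ⊆ E_m` of equal cardinality and any `ψ ∈ E_m`, in `ℤ[X]`:
`P_{O_m ∪ e₁}(X) - P_{O_m ∪ e₂}(X) = (P_{e₁}(X) - P_{e₂}(X)) · (P_{O_m}(X) - Q_ψ(X))`. -/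
theorem WLPP_difference_formula (m : ℕ) (hm : 2 ≤ m)
    (e₁ e₂ : Finset (V m)) (he₁ : e₁ ⊆ Em m) (he₂ : e₂ ⊆ Em m)
    (hcard : e₁.card = e₂.card) (ψ : V m) (hψ : ψ ∈ Em m) :
    WLPP m (Om m ∪ e₁) - WLPP m (Om m ∪ e₂) =
      (WLPP m e₁ - WLPP m e₂) * (WLPP m (Om m) - Qpoly m ψ) := by
  simp only [WLPP, wordCount, Qpoly, sum_sumCount_smul_eq_subsetSumPoly]
  rw [subsetSumPoly_Om_union m he₁ hψ, subsetSumPoly_Om_union m he₂ hψ, hcard]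
  ring
end
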